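/- Let φ : [-1,1]² → ℝ be a C² function with nonzero Hessian determinant, in the sense that inf_{(x,y)∈[-1,1]²} |φ_xx(x,y) φ_yy(x,y) − φ_xy(x,y)²| > 0. Then there exist constants C > 0 and A ≥ 0, depending only on φ, such that for every integer N ≥ 2 and every doubly indexed sequence of complex numbers (a_{n,m})_{n,m=-N}^{N}, one has ‖∑_{n,m=-N}^{N} a_{n,m} e(n x + m y + (n² + m²) φ(x,y))‖_{L²([-1,1]²)} ≤ C (log N)^A (∑_{n,m=-N}^{N} |a_{n,m}|²)^{1/2}. -/

import Mathlib

open MeasureTheory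

/-- `e z = e^{2πiz}`. -/
noncomputable def e (t : ℝ) : ℂ := Complex.exp (2 * Real.pi * Complex.I * t)

/-- The closed square `[-1,1]²`. -/
def Sq : Set (ℝ × ℝ) := Set.Icc (-1) 1 ×ˢ Set.Icc (-1) 1

theorem integral_inv_one_add_mul_abs_le {κ a b u₀ : ℝ} (hκ : 0 < κ) (ha : a ≤ u₀) (hb : u₀ ≤ b)
    (hab : b - a ≤ 2) :
    ∫ u in a..b, (1 + κ * |u - u₀|)⁻¹ ≤ 2 / κ * Real.log (1 + 2 * κ) := by
  have hcont : Continuous fun u : ℝ => (1 + κ * |u - u₀|)⁻¹ := by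
    refine Continuous.inv₀ (by fun_prop) fun u => ?_
    have := mul_nonneg hκ.le (abs_nonneg (u - u₀))
    linarith
  have hright : ∫ u in u₀..b, (1 + κ * |u - u₀|)⁻¹ = Real.log (1 + κ * (b - u₀)) / κ := by
    have := intervalIntegral.integral_eq_sub_of_hasDerivAt (a := u₀) (b := b)
      (f := fun u => Real.log (1 + κ * (u - u₀)) / κ) (f' := fun u => (1 + κ * |u - u₀|)⁻¹)
      (fun u hu => ?_) (hcont.intervalIntegrable _ _)
    · simpa using this
    · rw [Set.uIcc_of_le hb] at hu
      have h0 : 0 ≤ u - u₀ := sub_nonneg.2 hu.1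
      have hpos : 0 < 1 + κ * (u - u₀) := by positivity
      have h := (((((hasDerivAt_id u).sub_const u₀).const_mul κ).const_add 1).log
        hpos.ne').div_const κ
      refine h.congr_deriv ?_
      rw [abs_of_nonneg h0]
      simp only [id]
      field_simp
  have hleft : ∫ u in a..u₀, (1 + κ * |u - u₀|)⁻¹ = Real.log (1 + κ * (u₀ - a)) / κ := by
    have := intervalIntegral.integral_eq_sub_of_hasDerivAt (a := a) (b := u₀)
      (f := fun u => -(Real.log (1 + κ * (u₀ - u)) / κ)) (f' := fun u => (1 + κ * |u - u₀|)⁻¹)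
      (fun u hu => ?_) (hcont.intervalIntegrable _ _)
    · simpa using this
    · rw [Set.uIcc_of_le ha] at hu
      have h0 : 0 ≤ u₀ - u := sub_nonneg.2 hu.2
      have hpos : 0 < 1 + κ * (u₀ - u) := by positivity
      have h := ((((((hasDerivAt_id u).const_sub u₀).const_mul κ).const_add 1).log
        hpos.ne').div_const κ).neg
      refine h.congr_deriv ?_
      rw [abs_sub_comm, abs_of_nonneg h0]
      simp only [id]
      field_simp
  rw [← intervalIntegral.integral_add_adjacent_intervals (hcont.intervalIntegrable a u₀)
    (hcont.intervalIntegrable u₀ b), hleft, hright]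
  have h1 : Real.log (1 + κ * (u₀ - a)) ≤ Real.log (1 + 2 * κ) :=
    Real.log_le_log (by nlinarith) (by nlinarith)
  have h2 : Real.log (1 + κ * (b - u₀)) ≤ Real.log (1 + 2 * κ) :=
    Real.log_le_log (by nlinarith) (by nlinarith)
  rw [← add_div, div_mul_eq_mul_div]
  gcongr
  linarith

theorem norm_e (t : ℝ) : ‖e t‖ = 1 := by
  have : (2 * Real.pi * Complex.I * t : ℂ) = ((2 * Real.pi * t : ℝ) : ℂ) * Complex.I := by
    push_cast; ring
  rw [e, this, Complex.norm_exp_ofReal_mul_I]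

theorem hasDerivAt_e (t : ℝ) : HasDerivAt e (2 * Real.pi * Complex.I * e t) t := by
  have h := ((Complex.ofRealCLM.hasDerivAt (x := t)).const_mul (2 * Real.pi * Complex.I)).cexp
  refine h.congr_deriv ?_
  simp [e, mul_comm]

theorem continuous_e : Continuous e := by
  unfold e
  fun_prop

/-- The component along `ℓ` of the vector field `G / (|G|² + l) · e(Φ)`. -/
noncomputable def regField (Φ : ℝ × ℝ → ℝ) (G : ℝ × ℝ → ℝ × ℝ) (l : ℝ) (ℓ : ℝ × ℝ →L[ℝ] ℝ)
    (x : ℝ × ℝ) : ℂ :=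
  (ℓ (G x) * ((G x).1 ^ 2 + (G x).2 ^ 2 + l)⁻¹ : ℝ) • e (Φ x)

/-- The derivative of `regField` when `G` is the gradient of `Φ` and `H` the derivative of `G`. -/
noncomputable def regFieldDeriv (Φ : ℝ × ℝ → ℝ) (G : ℝ × ℝ → ℝ × ℝ)
    (H : ℝ × ℝ → ℝ × ℝ →L[ℝ] ℝ × ℝ) (l : ℝ) (ℓ : ℝ × ℝ →L[ℝ] ℝ) (x : ℝ × ℝ) :
    ℝ × ℝ →L[ℝ] ℂ :=
  (ℓ (G x) * ((G x).1 ^ 2 + (G x).2 ^ 2 + l)⁻¹) •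
      ((G x).1 • ContinuousLinearMap.fst ℝ ℝ ℝ +
        (G x).2 • ContinuousLinearMap.snd ℝ ℝ ℝ).smulRight (2 * Real.pi * Complex.I * e (Φ x)) +
    (((G x).1 ^ 2 + (G x).2 ^ 2 + l)⁻¹ • ℓ.comp (H x) -
      (2 * ℓ (G x) * (((G x).1 ^ 2 + (G x).2 ^ 2 + l) ^ 2)⁻¹) •
        ((G x).1 • (ContinuousLinearMap.fst ℝ ℝ ℝ).comp (H x) +
          (G x).2 • (ContinuousLinearMap.snd ℝ ℝ ℝ).comp (H x))).smulRight (e (Φ x))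

theorem hasFDerivAt_regField {Φ : ℝ × ℝ → ℝ} {G : ℝ × ℝ → ℝ × ℝ}
    {H : ℝ × ℝ → ℝ × ℝ →L[ℝ] ℝ × ℝ} {l : ℝ} (hl : 0 < l) (ℓ : ℝ × ℝ →L[ℝ] ℝ) {x : ℝ × ℝ}
    (hΦ : HasFDerivAt Φ ((G x).1 • ContinuousLinearMap.fst ℝ ℝ ℝ +
      (G x).2 • ContinuousLinearMap.snd ℝ ℝ ℝ) x)
    (hG : HasFDerivAt G (H x) x) :
    HasFDerivAt (regField Φ G l ℓ) (regFieldDeriv Φ G H l ℓ x) x := by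
  have hR : (G x).1 ^ 2 + (G x).2 ^ 2 + l ≠ 0 := by positivity
  have hF := (hasDerivAt_e (Φ x)).hasFDerivAt.comp x hΦ
  have h1 := hG.fst
  have h2 := hG.snd
  have hinv := (hasDerivAt_inv hR).comp_hasFDerivAt x (((h1.pow 2).add (h2.pow 2)).add_const l)
  have hV := (ℓ.hasFDerivAt.comp x hG).mul hinv
  refine (hV.smul hF).congr_fderiv ?_
  ext <;>
  · simp [regFieldDeriv, ContinuousLinearMap.smulRight_apply]
    ring_nf
    simp

theorem abs_divergence_le {p q l M h₁₁ h₁₂ h₂₁ h₂₂ : ℝ} (hl : 0 < l) (h1 : |h₁₁| ≤ M)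
    (h2 : |h₁₂| ≤ M) (h3 : |h₂₁| ≤ M) (h4 : |h₂₂| ≤ M) :
    |(p ^ 2 + q ^ 2 + l)⁻¹ * (h₁₁ + h₂₂) - 2 * ((p ^ 2 + q ^ 2 + l) ^ 2)⁻¹ *
      (p * (p * h₁₁ + q * h₂₁) + q * (p * h₁₂ + q * h₂₂))| ≤ 6 * M * (p ^ 2 + q ^ 2 + l)⁻¹ := by
  have hM : 0 ≤ M := (abs_nonneg _).trans h1
  set R := p ^ 2 + q ^ 2 + l with hR
  have hRpos : 0 < R := by positivity
  have ha : |h₁₁ + h₂₂| ≤ 2 * M := (abs_add_le _ _).trans (by linarith)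
  have hb : |p * (p * h₁₁ + q * h₂₁) + q * (p * h₁₂ + q * h₂₂)| ≤ 2 * M * R := by
    have e1 : |p * (p * h₁₁ + q * h₂₁) + q * (p * h₁₂ + q * h₂₂)| ≤
        (|p| * |p| * M + |p| * |q| * M) + (|q| * |p| * M + |q| * |q| * M) := by
      refine (abs_add_le _ _).trans (add_le_add ?_ ?_) <;>
      · rw [mul_add]
        refine (abs_add_le _ _).trans (add_le_add ?_ ?_) <;>
        · rw [← mul_assoc, abs_mul, abs_mul]
          gcongr
    have e2 : p ^ 2 + q ^ 2 ≤ R := by linarith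
    have e3 : |p| ^ 2 = p ^ 2 := sq_abs p
    have e4 : |q| ^ 2 = q ^ 2 := sq_abs q
    have e5 : (|p| + |q|) ^ 2 ≤ 2 * R := by nlinarith [sq_nonneg (|p| - |q|)]
    nlinarith
  calc _ ≤ |R⁻¹ * (h₁₁ + h₂₂)| + |2 * (R ^ 2)⁻¹ *
      (p * (p * h₁₁ + q * h₂₁) + q * (p * h₁₂ + q * h₂₂))| := abs_sub _ _
    _ ≤ R⁻¹ * (2 * M) + 2 * (R ^ 2)⁻¹ * (2 * M * R) := by
      rw [abs_mul, abs_mul _ (_ + _), abs_of_pos (inv_pos.2 hRpos),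
        abs_of_pos (show 0 < 2 * (R ^ 2)⁻¹ by positivity)]
      gcongr
    _ = 6 * M * R⁻¹ := by field_simp; ring

theorem norm_divergence_regField_sub_le {Φ : ℝ × ℝ → ℝ} {G : ℝ × ℝ → ℝ × ℝ}
    {H : ℝ × ℝ → ℝ × ℝ →L[ℝ] ℝ × ℝ} {l B : ℝ} (hl : 0 < l) {x : ℝ × ℝ}
    (hH : ‖H x‖ ≤ B * l) :
    ‖regFieldDeriv Φ G H l (ContinuousLinearMap.fst ℝ ℝ ℝ) x (1, 0) +
      regFieldDeriv Φ G H l (ContinuousLinearMap.snd ℝ ℝ ℝ) x (0, 1) -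
        2 * Real.pi * Complex.I * e (Φ x)‖ ≤
      (6 * B + 2 * Real.pi) * (l * ((G x).1 ^ 2 + (G x).2 ^ 2 + l)⁻¹) := by
  have hv : ∀ v : ℝ × ℝ, ‖v‖ ≤ 1 → |(H x v).1| ≤ B * l ∧ |(H x v).2| ≤ B * l := by
    intro v hv
    have h := (H x).le_opNorm_of_le hv
    rw [mul_one] at h
    exact ⟨((norm_fst_le _).trans h).trans hH, ((norm_snd_le _).trans h).trans hH⟩
  have hv1 := hv (1, 0) (by simp [Prod.norm_def])
  have hv2 := hv (0, 1) (by simp [Prod.norm_def])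
  have hD := abs_divergence_le (p := (G x).1) (q := (G x).2) hl hv1.1 hv2.1 hv1.2 hv2.2
  have hR : 0 < (G x).1 ^ 2 + (G x).2 ^ 2 + l := by positivity
  set D : ℝ := _ with hDdef
  change |D| ≤ _ at hD
  have hRC : (((G x).1 : ℂ) ^ 2 + ((G x).2 : ℂ) ^ 2 + (l : ℂ)) ≠ 0 := by exact_mod_cast hR.ne'
  have key : regFieldDeriv Φ G H l (ContinuousLinearMap.fst ℝ ℝ ℝ) x (1, 0) +
      regFieldDeriv Φ G H l (ContinuousLinearMap.snd ℝ ℝ ℝ) x (0, 1) -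
        2 * Real.pi * Complex.I * e (Φ x) =
      ((D : ℂ) - ((2 * Real.pi * (l * ((G x).1 ^ 2 + (G x).2 ^ 2 + l)⁻¹) : ℝ) : ℂ) * Complex.I) *
        e (Φ x) := by
    simp only [regFieldDeriv, hDdef]
    simp
    field_simp
    ring
  rw [key, norm_mul, norm_e, mul_one]
  refine (norm_sub_le _ _).trans ?_
  rw [norm_mul, Complex.norm_I, mul_one, Complex.norm_real, Complex.norm_real, Real.norm_eq_abs,
    Real.norm_of_nonneg (by positivity)]
  linarith

theorem one_add_mul_one_add_le {s t : ℝ} (hs : 0 ≤ s) (ht : 0 ≤ t) {m : ℝ} (hsm : s ≤ m)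
    (htm : t ≤ m) : (1 + s) * (1 + t) ≤ 2 * (1 + m ^ 2) := by
  have : (1 + s) * (1 + t) ≤ (1 + m) * (1 + m) :=
    mul_le_mul (by linarith) (by linarith) (by linarith) (by linarith)
  nlinarith [sq_nonneg (1 - m)]

/-- If `|G|` grows at least like `c l |x - x₀|`, then `l / (|G|² + l)` is dominated by a product of
one-variable weights. -/
theorem mul_inv_le_weight {G x x₀ : ℝ × ℝ} {c l : ℝ} (hc : 0 < c) (hl : 0 < l)
    (hG : c * l * ‖x - x₀‖ ≤ ‖G‖) :
    l * (G.1 ^ 2 + G.2 ^ 2 + l)⁻¹ ≤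
      2 * ((1 + c * √l * |x.1 - x₀.1|)⁻¹ * (1 + c * √l * |x.2 - x₀.2|)⁻¹) := by
  have h1 : |x.1 - x₀.1| ≤ ‖x - x₀‖ := norm_fst_le (x - x₀)
  have h2 : |x.2 - x₀.2| ≤ ‖x - x₀‖ := norm_snd_le (x - x₀)
  have hprod := one_add_mul_one_add_le (s := c * √l * |x.1 - x₀.1|) (t := c * √l * |x.2 - x₀.2|)
    (m := c * √l * ‖x - x₀‖) (by positivity) (by positivity) (by gcongr) (by gcongr)
  have hsq : ‖G‖ ^ 2 ≤ G.1 ^ 2 + G.2 ^ 2 := by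
    rw [Prod.norm_def]
    rcases max_choice ‖G.1‖ ‖G.2‖ with h | h <;> rw [h, Real.norm_eq_abs, sq_abs]
    · nlinarith [sq_nonneg G.2]
    · nlinarith [sq_nonneg G.1]
  have hlow : l * (1 + (c * √l * ‖x - x₀‖) ^ 2) ≤ G.1 ^ 2 + G.2 ^ 2 + l := by
    have : (c * l * ‖x - x₀‖) ^ 2 ≤ ‖G‖ ^ 2 := by gcongr
    have h3 : √l ^ 2 = l := Real.sq_sqrt hl.le
    calc l * (1 + (c * √l * ‖x - x₀‖) ^ 2) = l + (c * ‖x - x₀‖) ^ 2 * l * (√l ^ 2) := by ring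
      _ = (c * l * ‖x - x₀‖) ^ 2 + l := by rw [h3]; ring
      _ ≤ _ := by linarith
  have hpos : 0 < (1 + c * √l * |x.1 - x₀.1|) * (1 + c * √l * |x.2 - x₀.2|) := by positivity
  rw [← mul_inv, ← div_eq_mul_inv, ← div_eq_mul_inv, div_le_div_iff₀ (by positivity) hpos]
  nlinarith

theorem norm_regField_le {Φ : ℝ × ℝ → ℝ} {G : ℝ × ℝ → ℝ × ℝ} {c l : ℝ} {x x₀ : ℝ × ℝ}
    (hc : 0 < c) (hl : 0 < l) (hG : c * l * ‖x - x₀‖ ≤ ‖G x‖) (ℓ : ℝ × ℝ →L[ℝ] ℝ)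
    (hℓ : |ℓ (G x)| ≤ ‖G x‖) {i : ℝ} (hi : |i| ≤ ‖x - x₀‖) :
    ‖regField Φ G l ℓ x‖ ≤ 2 / √l * (1 + c * √l * |i|)⁻¹ := by
  have hsq : ‖G x‖ ^ 2 ≤ (G x).1 ^ 2 + (G x).2 ^ 2 := by
    rw [Prod.norm_def]
    rcases max_choice ‖(G x).1‖ ‖(G x).2‖ with h | h <;> rw [h, Real.norm_eq_abs, sq_abs]
    · nlinarith [sq_nonneg (G x).2]
    · nlinarith [sq_nonneg (G x).1]
  have hsl : 0 < √l := Real.sqrt_pos.2 hl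
  have h3 : √l ^ 2 = l := Real.sq_sqrt hl.le
  have hlow : √l * (√l * |i| * c) ≤ ‖G x‖ := by
    calc √l * (√l * |i| * c) = c * √l ^ 2 * |i| := by ring
      _ ≤ c * l * ‖x - x₀‖ := by rw [h3]; gcongr
      _ ≤ _ := hG
  have hR : 0 < (G x).1 ^ 2 + (G x).2 ^ 2 + l := by positivity
  rw [regField, norm_smul, norm_e, mul_one, norm_mul, Real.norm_eq_abs, Real.norm_eq_abs,
    abs_of_pos (inv_pos.2 hR), ← div_eq_mul_inv, ← div_eq_mul_inv, div_div,
    div_le_div_iff₀ hR (by positivity)]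
  calc |ℓ (G x)| * (√l * (1 + c * √l * |i|))
      ≤ ‖G x‖ * (√l + ‖G x‖) := by
        gcongr
        linarith
    _ ≤ 2 * (‖G x‖ ^ 2 + √l ^ 2) := by nlinarith [sq_nonneg (‖G x‖ - √l)]
    _ ≤ _ := by rw [h3]; linarith

theorem norm_intervalIntegral_le_of_weight {f : ℝ → ℂ} {a b u₀ κ K : ℝ} (hκ : 0 < κ) (hK : 0 ≤ K)
    (ha : a ≤ u₀) (hb : u₀ ≤ b) (hab : b - a ≤ 2)
    (hf : ∀ u ∈ Set.Icc a b, ‖f u‖ ≤ K * (1 + κ * |u - u₀|)⁻¹) :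
    ‖∫ u in a..b, f u‖ ≤ K * (2 / κ * Real.log (1 + 2 * κ)) := by
  have hcont : Continuous fun u : ℝ => (1 + κ * |u - u₀|)⁻¹ := by
    refine Continuous.inv₀ (by fun_prop) fun u => ?_
    have := mul_nonneg hκ.le (abs_nonneg (u - u₀))
    linarith
  calc ‖∫ u in a..b, f u‖ ≤ ∫ u in a..b, K * (1 + κ * |u - u₀|)⁻¹ :=
        intervalIntegral.norm_integral_le_of_norm_le (ha.trans hb)
          (ae_of_all _ fun u hu => hf u (Set.Ioc_subset_Icc_self hu))
          ((continuous_const.mul hcont).intervalIntegrable _ _)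
    _ ≤ _ := by
        rw [intervalIntegral.integral_const_mul]
        gcongr
        exact integral_inv_one_add_mul_abs_le hκ ha hb hab

/-- Stationary phase bound on a box for a `C²` phase, with logarithmic loss. -/
theorem norm_integral_e_le {Φ : ℝ × ℝ → ℝ} {G : ℝ × ℝ → ℝ × ℝ} {H : ℝ × ℝ → ℝ × ℝ →L[ℝ] ℝ × ℝ}
    {a b x₀ : ℝ × ℝ} {B c l : ℝ} (hx₀ : x₀ ∈ Set.Icc a b) (hab₁ : b.1 - a.1 ≤ 2)
    (hab₂ : b.2 - a.2 ≤ 2) (hB : 0 ≤ B) (hc : 0 < c) (hc₁ : c ≤ 1) (hl : 1 ≤ l)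
    (hΦc : ContinuousOn Φ (Set.Icc a b)) (hGc : ContinuousOn G (Set.Icc a b))
    (hHc : ContinuousOn H (Set.Icc a b))
    (hΦ : ∀ x ∈ Set.Ioo a.1 b.1 ×ˢ Set.Ioo a.2 b.2,
      HasFDerivAt Φ ((G x).1 • ContinuousLinearMap.fst ℝ ℝ ℝ +
        (G x).2 • ContinuousLinearMap.snd ℝ ℝ ℝ) x)
    (hG : ∀ x ∈ Set.Ioo a.1 b.1 ×ˢ Set.Ioo a.2 b.2, HasFDerivAt G (H x) x)
    (hH : ∀ x ∈ Set.Icc a b, ‖H x‖ ≤ B * l)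
    (hlow : ∀ x ∈ Set.Icc a b, c * l * ‖x - x₀‖ ≤ ‖G x‖) :
    ‖∫ x in Set.Icc a b, e (Φ x)‖ ≤
      (48 * B + 64) / c ^ 2 * (Real.log (1 + 2 * √l) ^ 2 / l) := by
  have hl0 : 0 < l := by linarith
  have hsl : 0 < √l := Real.sqrt_pos.2 hl0
  have hab : a ≤ b := hx₀.1.trans hx₀.2
  have hκ : 0 < c * √l := by positivity
  set J : ℝ := 2 / (c * √l) * Real.log (1 + 2 * (c * √l)) with hJ
  have hRc : ContinuousOn (fun x => ((G x).1 ^ 2 + (G x).2 ^ 2 + l)⁻¹) (Set.Icc a b) := by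
    refine ContinuousOn.inv₀ ?_ fun x _ => ?_
    · exact ((hGc.fst.pow 2).add (hGc.snd.pow 2)).add continuousOn_const
    · positivity
  have hec : ContinuousOn (fun x => e (Φ x)) (Set.Icc a b) := continuous_e.comp_continuousOn hΦc
  have hfc : ∀ ℓ : ℝ × ℝ →L[ℝ] ℝ, ContinuousOn (regField Φ G l ℓ) (Set.Icc a b) := fun ℓ =>
    ((ℓ.continuous.comp_continuousOn hGc).mul hRc).smul hec
  have hf'c : ∀ (ℓ : ℝ × ℝ →L[ℝ] ℝ) (v : ℝ × ℝ),
      ContinuousOn (fun x => regFieldDeriv Φ G H l ℓ x v) (Set.Icc a b) := by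
    intro ℓ v
    have hHv : ContinuousOn (fun x => H x v) (Set.Icc a b) := hHc.clm_apply continuousOn_const
    have hℓG : ContinuousOn (fun x => ℓ (G x)) (Set.Icc a b) := ℓ.continuous.comp_continuousOn hGc
    have hℓH : ContinuousOn (fun x => ℓ (H x v)) (Set.Icc a b) :=
      ℓ.continuous.comp_continuousOn hHv
    have h1 := hGc.fst
    have h2 := hGc.snd
    have h3 := hHv.fst
    have h4 := hHv.snd
    have hR2 : ContinuousOn (fun x => (((G x).1 ^ 2 + (G x).2 ^ 2 + l) ^ 2)⁻¹) (Set.Icc a b) := by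
      simpa only [Pi.pow_def, inv_pow] using hRc.pow 2
    simp only [regFieldDeriv, add_apply, smul_apply,
      sub_apply, ContinuousLinearMap.smulRight_apply,
      ContinuousLinearMap.comp_apply, ContinuousLinearMap.coe_fst', ContinuousLinearMap.coe_snd',
      smul_eq_mul]
    fun_prop
  have hfst : ∀ x : ℝ × ℝ, |ContinuousLinearMap.fst ℝ ℝ ℝ (G x)| ≤ ‖G x‖ := fun x =>
    norm_fst_le (G x)
  have hsnd : ∀ x : ℝ × ℝ, |ContinuousLinearMap.snd ℝ ℝ ℝ (G x)| ≤ ‖G x‖ := fun x =>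
    norm_snd_le (G x)
  have hdiv := integral_divergence_prod_Icc_of_hasFDerivAt_off_countable_of_le
    (regField Φ G l (ContinuousLinearMap.fst ℝ ℝ ℝ))
    (regField Φ G l (ContinuousLinearMap.snd ℝ ℝ ℝ))
    (regFieldDeriv Φ G H l (ContinuousLinearMap.fst ℝ ℝ ℝ))
    (regFieldDeriv Φ G H l (ContinuousLinearMap.snd ℝ ℝ ℝ)) a b hab ∅ Set.countable_empty
    (hfc _) (hfc _)
    (fun x hx => hasFDerivAt_regField hl0 _ (hΦ x hx.1) (hG x hx.1))
    (fun x hx => hasFDerivAt_regField hl0 _ (hΦ x hx.1) (hG x hx.1))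
    (((hf'c _ _).add (hf'c _ _)).integrableOn_compact isCompact_Icc)
  have hB1 : ‖∫ x in a.1..b.1, regField Φ G l (ContinuousLinearMap.snd ℝ ℝ ℝ) (x, b.2)‖ ≤
      2 / √l * J := by
    refine norm_intervalIntegral_le_of_weight hκ (by positivity) hx₀.1.1 hx₀.2.1 hab₁ ?_
    intro u hu
    exact norm_regField_le hc hl0 (hlow (u, b.2) ⟨⟨hu.1, hab.2⟩, ⟨hu.2, le_rfl⟩⟩) _ (hsnd _)
      (norm_fst_le ((u, b.2) - x₀))
  have hB2 : ‖∫ x in a.1..b.1, regField Φ G l (ContinuousLinearMap.snd ℝ ℝ ℝ) (x, a.2)‖ ≤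
      2 / √l * J := by
    refine norm_intervalIntegral_le_of_weight hκ (by positivity) hx₀.1.1 hx₀.2.1 hab₁ ?_
    intro u hu
    exact norm_regField_le hc hl0 (hlow (u, a.2) ⟨⟨hu.1, le_rfl⟩, ⟨hu.2, hab.2⟩⟩) _ (hsnd _)
      (norm_fst_le ((u, a.2) - x₀))
  have hB3 : ‖∫ y in a.2..b.2, regField Φ G l (ContinuousLinearMap.fst ℝ ℝ ℝ) (b.1, y)‖ ≤
      2 / √l * J := by
    refine norm_intervalIntegral_le_of_weight hκ (by positivity) hx₀.1.2 hx₀.2.2 hab₂ ?_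
    intro u hu
    exact norm_regField_le hc hl0 (hlow (b.1, u) ⟨⟨hab.1, hu.1⟩, ⟨le_rfl, hu.2⟩⟩) _ (hfst _)
      (norm_snd_le ((b.1, u) - x₀))
  have hB4 : ‖∫ y in a.2..b.2, regField Φ G l (ContinuousLinearMap.fst ℝ ℝ ℝ) (a.1, y)‖ ≤
      2 / √l * J := by
    refine norm_intervalIntegral_le_of_weight hκ (by positivity) hx₀.1.2 hx₀.2.2 hab₂ ?_
    intro u hu
    exact norm_regField_le hc hl0 (hlow (a.1, u) ⟨⟨le_rfl, hu.1⟩, ⟨hab.1, hu.2⟩⟩) _ (hfst _)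
      (norm_snd_le ((a.1, u) - x₀))
  have hbdry : ‖∫ x in Set.Icc a b, (regFieldDeriv Φ G H l (ContinuousLinearMap.fst ℝ ℝ ℝ) x (1, 0) +
      regFieldDeriv Φ G H l (ContinuousLinearMap.snd ℝ ℝ ℝ) x (0, 1))‖ ≤ 4 * (2 / √l * J) := by
    rw [hdiv]
    refine (norm_sub_le _ _).trans ?_
    have h1 := (norm_add_le ((∫ x in a.1..b.1,
      regField Φ G l (ContinuousLinearMap.snd ℝ ℝ ℝ) (x, b.2)) - ∫ x in a.1..b.1,
        regField Φ G l (ContinuousLinearMap.snd ℝ ℝ ℝ) (x, a.2))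
      (∫ y in a.2..b.2, regField Φ G l (ContinuousLinearMap.fst ℝ ℝ ℝ) (b.1, y))).trans
      (add_le_add_left (norm_sub_le _ _) _)
    linarith
  have hwc : ∀ u₀ : ℝ, Continuous fun u : ℝ => (1 + c * √l * |u - u₀|)⁻¹ := by
    intro u₀
    refine Continuous.inv₀ (by fun_prop) fun u => ?_
    positivity
  have hJ0 : 0 ≤ J := mul_nonneg (by positivity) (Real.log_nonneg (by linarith))
  have hw : ∫ x in Set.Icc a b, (1 + c * √l * |x.1 - x₀.1|)⁻¹ * (1 + c * √l * |x.2 - x₀.2|)⁻¹ ≤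
      J * J := by
    have h := setIntegral_prod_mul (μ := (volume : Measure ℝ)) (ν := (volume : Measure ℝ))
      (fun u : ℝ => (1 + c * √l * |u - x₀.1|)⁻¹) (fun u : ℝ => (1 + c * √l * |u - x₀.2|)⁻¹)
      (Set.Icc a.1 b.1) (Set.Icc a.2 b.2)
    rw [Set.Icc_prod_eq, Measure.volume_eq_prod, h, integral_Icc_eq_integral_Ioc,
      integral_Icc_eq_integral_Ioc, ← intervalIntegral.integral_of_le hab.1,
      ← intervalIntegral.integral_of_le hab.2]
    refine mul_le_mul (integral_inv_one_add_mul_abs_le hκ hx₀.1.1 hx₀.2.1 hab₁)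
      (integral_inv_one_add_mul_abs_le hκ hx₀.1.2 hx₀.2.2 hab₂) ?_ hJ0
    exact intervalIntegral.integral_nonneg hab.2 fun u _ => by positivity
  have herr : ‖∫ x in Set.Icc a b, (regFieldDeriv Φ G H l (ContinuousLinearMap.fst ℝ ℝ ℝ) x (1, 0) +
      regFieldDeriv Φ G H l (ContinuousLinearMap.snd ℝ ℝ ℝ) x (0, 1) -
        2 * Real.pi * Complex.I * e (Φ x))‖ ≤ (6 * B + 2 * Real.pi) * (2 * (J * J)) := by
    calc _ ≤ ∫ x in Set.Icc a b, (6 * B + 2 * Real.pi) *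
          (2 * ((1 + c * √l * |x.1 - x₀.1|)⁻¹ * (1 + c * √l * |x.2 - x₀.2|)⁻¹)) := by
          refine norm_integral_le_of_norm_le ?_ ?_
          · refine Continuous.integrableOn_Icc ?_
            have h1 := (hwc x₀.1).comp (continuous_fst (X := ℝ) (Y := ℝ))
            have h2 := (hwc x₀.2).comp (continuous_snd (X := ℝ) (Y := ℝ))
            exact continuous_const.mul (continuous_const.mul (h1.mul h2))
          · refine (ae_restrict_iff' measurableSet_Icc).2 (ae_of_all _ fun x hx => ?_)
            refine (norm_divergence_regField_sub_le hl0 (hH x hx)).trans ?_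
            have := mul_inv_le_weight hc hl0 (hlow x hx)
            have := Real.pi_pos
            gcongr
      _ ≤ _ := by
          rw [integral_const_mul, integral_const_mul]
          have := Real.pi_pos
          gcongr
  have hint₁ : IntegrableOn (fun x => regFieldDeriv Φ G H l (ContinuousLinearMap.fst ℝ ℝ ℝ) x (1, 0) +
      regFieldDeriv Φ G H l (ContinuousLinearMap.snd ℝ ℝ ℝ) x (0, 1)) (Set.Icc a b) :=
    ((hf'c _ _).add (hf'c _ _)).integrableOn_compact isCompact_Icc
  have hint₂ : IntegrableOn (fun x => 2 * Real.pi * Complex.I * e (Φ x)) (Set.Icc a b) :=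
    (continuousOn_const.mul hec).integrableOn_compact isCompact_Icc
  rw [integral_sub hint₁ hint₂, integral_const_mul] at herr
  have hmain : 2 * Real.pi * ‖∫ x in Set.Icc a b, e (Φ x)‖ ≤
      4 * (2 / √l * J) + (6 * B + 2 * Real.pi) * (2 * (J * J)) := by
    have h1 : ‖2 * Real.pi * Complex.I * ∫ x in Set.Icc a b, e (Φ x)‖ =
        2 * Real.pi * ‖∫ x in Set.Icc a b, e (Φ x)‖ := by
      simp [abs_of_pos Real.pi_pos]
    rw [← h1]
    have h2 := norm_sub_norm_le (2 * Real.pi * Complex.I * ∫ x in Set.Icc a b, e (Φ x))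
      (∫ x in Set.Icc a b, (regFieldDeriv Φ G H l (ContinuousLinearMap.fst ℝ ℝ ℝ) x (1, 0) +
      regFieldDeriv Φ G H l (ContinuousLinearMap.snd ℝ ℝ ℝ) x (0, 1)))
    rw [norm_sub_rev] at herr
    linarith
  set L := Real.log (1 + 2 * √l) with hL
  have hs1 : 1 ≤ √l := Real.one_le_sqrt.2 hl
  have hL1 : 1 ≤ L := by
    rw [hL, Real.le_log_iff_exp_le (by positivity)]
    linarith [Real.exp_one_lt_d9]
  have hlog : Real.log (1 + 2 * (c * √l)) ≤ L := by
    refine Real.log_le_log (by positivity) ?_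
    nlinarith
  have hJL : J ≤ 2 / (c * √l) * L := by rw [hJ]; gcongr
  have h3 : √l ^ 2 = l := Real.sq_sqrt hl0.le
  have hJJ : J * J ≤ 4 / c ^ 2 * (L ^ 2 / l) := by
    calc J * J ≤ (2 / (c * √l) * L) * (2 / (c * √l) * L) := by gcongr
      _ = 4 / c ^ 2 * (L ^ 2 / √l ^ 2) := by field_simp; ring
      _ = _ := by rw [h3]
  have hJ1 : 2 / √l * J ≤ 4 / c ^ 2 * (L ^ 2 / l) := by
    calc 2 / √l * J ≤ 2 / √l * (2 / (c * √l) * L) := by gcongr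
      _ = 4 / c * (L / √l ^ 2) := by field_simp; ring
      _ = 4 / c * (L / l) := by rw [h3]
      _ ≤ _ := by
        gcongr ?_ * (?_ / l)
        · exact div_le_div_of_nonneg_left (by norm_num) (by positivity) (by nlinarith)
        · nlinarith
  set X := L ^ 2 / l with hX
  have hX0 : 0 ≤ X := by positivity
  have hpi := Real.pi_gt_three
  have hpi4 := Real.pi_le_four
  have hcX : 0 ≤ 4 / c ^ 2 * X := by positivity
  have hfin : 2 * Real.pi * ‖∫ x in Set.Icc a b, e (Φ x)‖ ≤
      (12 * B + 20) * (4 / c ^ 2 * X) := by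
    refine hmain.trans ?_
    calc 4 * (2 / √l * J) + (6 * B + 2 * Real.pi) * (2 * (J * J))
        ≤ 4 * (4 / c ^ 2 * X) + (6 * B + 2 * 4) * (2 * (4 / c ^ 2 * X)) := by gcongr
      _ = _ := by ring
  have heq : (48 * B + 64) / c ^ 2 * X = (12 * B + 16) * (4 / c ^ 2 * X) := by ring
  rw [heq]
  have hn := norm_nonneg (∫ x in Set.Icc a b, e (Φ x))
  nlinarith

theorem Sq_eq_Icc : Sq = Set.Icc ((-1, -1) : ℝ × ℝ) (1, 1) := by
  rw [Sq, Set.Icc_prod_eq]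

theorem uniqueDiffOn_Sq : UniqueDiffOn ℝ Sq :=
  (uniqueDiffOn_Icc (by norm_num)).prod (uniqueDiffOn_Icc (by norm_num))

theorem isCompact_Sq : IsCompact Sq := isCompact_Icc.prod isCompact_Icc

theorem closure_interior_Sq : closure (interior Sq) = Sq := by
  rw [Sq, interior_prod_eq, interior_Icc, closure_prod_eq, closure_Ioo (by norm_num)]

/-- Evaluation of a linear form at the two basis vectors. -/
noncomputable def evalBasis : (ℝ × ℝ →L[ℝ] ℝ) →L[ℝ] ℝ × ℝ :=
  (ContinuousLinearMap.apply ℝ ℝ ((1, 0) : ℝ × ℝ)).prod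
    (ContinuousLinearMap.apply ℝ ℝ ((0, 1) : ℝ × ℝ))

/-- The gradient of `φ` on the closed square. -/
noncomputable def gradSq (φ : ℝ × ℝ → ℝ) (x : ℝ × ℝ) : ℝ × ℝ :=
  evalBasis (fderivWithin ℝ φ Sq x)

theorem contDiffOn_gradSq {φ : ℝ × ℝ → ℝ} (hφ : ContDiffOn ℝ 2 φ Sq) :
    ContDiffOn ℝ 1 (gradSq φ) Sq :=
  evalBasis.contDiff.comp_contDiffOn (hφ.fderivWithin uniqueDiffOn_Sq (by norm_num))

theorem hasFDerivAt_of_gradSq {φ : ℝ × ℝ → ℝ} (hφ : ContDiffOn ℝ 2 φ Sq) {x : ℝ × ℝ}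
    (hx : Sq ∈ nhds x) :
    HasFDerivAt φ ((gradSq φ x).1 • ContinuousLinearMap.fst ℝ ℝ ℝ +
      (gradSq φ x).2 • ContinuousLinearMap.snd ℝ ℝ ℝ) x := by
  have h := ((hφ.differentiableOn (by norm_num)) x (mem_of_mem_nhds hx)).hasFDerivWithinAt.hasFDerivAt hx
  refine h.congr_fderiv ?_
  ext <;> simp [gradSq, evalBasis]

theorem fderivWithin_gradSq_injective {φ : ℝ × ℝ → ℝ} (hφ : ContDiffOn ℝ 2 φ Sq) {p : ℝ × ℝ}
    (hp : p ∈ Sq)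
    (hdet : iteratedFDerivWithin ℝ 2 φ Sq p ![(1, 0), (1, 0)] *
      iteratedFDerivWithin ℝ 2 φ Sq p ![(0, 1), (0, 1)] -
        iteratedFDerivWithin ℝ 2 φ Sq p ![(1, 0), (0, 1)] ^ 2 ≠ 0) :
    Function.Injective (fderivWithin ℝ (gradSq φ) Sq p) := by
  set D := fderivWithin ℝ (fderivWithin ℝ φ Sq) Sq p with hD
  have hsymm : ∀ u v, D u v = D v u :=
    (hφ p hp).isSymmSndFDerivWithinAt (by simp) uniqueDiffOn_Sq
      (by rw [closure_interior_Sq]; exact hp) hp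
  have hdiff : DifferentiableWithinAt ℝ (fderivWithin ℝ φ Sq) Sq p :=
    (hφ.fderivWithin (m := 1) uniqueDiffOn_Sq (by norm_num)).differentiableOn (by norm_num) p hp
  have hval : fderivWithin ℝ (gradSq φ) Sq p = evalBasis.comp D :=
    (evalBasis.hasFDerivAt.comp_hasFDerivWithinAt p hdiff.hasFDerivWithinAt).fderivWithin
      (uniqueDiffOn_Sq p hp)
  rw [iteratedFDerivWithin_two_apply' _ uniqueDiffOn_Sq hp,
    iteratedFDerivWithin_two_apply' _ uniqueDiffOn_Sq hp,
    iteratedFDerivWithin_two_apply' _ uniqueDiffOn_Sq hp] at hdet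
  rw [hval, injective_iff_map_eq_zero]
  intro v hv
  have hdec : v = v.1 • ((1, 0) : ℝ × ℝ) + v.2 • ((0, 1) : ℝ × ℝ) := by ext <;> simp
  have h12 := hsymm (1, 0) (0, 1)
  have e1 : D v (1, 0) = 0 := congrArg Prod.fst hv
  have e2 : D v (0, 1) = 0 := congrArg Prod.snd hv
  rw [hdec] at e1 e2
  simp only [map_add, map_smul, add_apply, smul_apply, smul_eq_mul] at e1 e2
  rw [← h12] at e1
  ext
  · refine (mul_eq_zero.1 (?_ : _ * v.1 = 0)).resolve_left hdet
    linear_combination D (0, 1) (0, 1) * e1 - D (1, 0) (0, 1) * e2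
  · refine (mul_eq_zero.1 (?_ : _ * v.2 = 0)).resolve_left hdet
    linear_combination D (1, 0) (1, 0) * e2 - D (1, 0) (0, 1) * e1

/-- Every point of the square has a box neighbourhood on which the gradient of `φ` is
antilipschitz. -/
theorem exists_box_gradSq_antilipschitz {φ : ℝ × ℝ → ℝ} (hφ : ContDiffOn ℝ 2 φ Sq) {p : ℝ × ℝ}
    (hp : p ∈ Sq)
    (hdet : iteratedFDerivWithin ℝ 2 φ Sq p ![(1, 0), (1, 0)] *
      iteratedFDerivWithin ℝ 2 φ Sq p ![(0, 1), (0, 1)] -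
        iteratedFDerivWithin ℝ 2 φ Sq p ![(1, 0), (0, 1)] ^ 2 ≠ 0) :
    ∃ a b : ℝ × ℝ, Set.Icc a b ⊆ Sq ∧ p ∈ Set.Icc a b ∧ Set.Icc a b ∈ nhdsWithin p Sq ∧ ∃ c > 0,
      ∀ x ∈ Set.Icc a b, ∀ y ∈ Set.Icc a b, c * ‖x - y‖ ≤ ‖gradSq φ x - gradSq φ y‖ := by
  have hg := contDiffOn_gradSq hφ
  have hinj := fderivWithin_gradSq_injective hφ hp hdet
  set D := fderivWithin ℝ (gradSq φ) Sq p with hD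
  obtain ⟨K, hK, hKD⟩ := (D : ℝ × ℝ →ₗ[ℝ] ℝ × ℝ).exists_antilipschitzWith
    (LinearMap.ker_eq_bot.2 hinj)
  have hK' : (0 : ℝ) < K := hK
  have hcont : ContinuousWithinAt (fderivWithin ℝ (gradSq φ) Sq) Sq p :=
    hg.continuousOn_fderivWithin uniqueDiffOn_Sq le_rfl p hp
  have hev : {x | ‖fderivWithin ℝ (gradSq φ) Sq x - D‖ ≤ (2 * (K : ℝ))⁻¹} ∈ nhdsWithin p Sq := by
    filter_upwards [Metric.tendsto_nhds.1 hcont (2 * (K : ℝ))⁻¹ (by positivity)] with x hx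
    rw [← dist_eq_norm]
    exact hx.le
  obtain ⟨r, hr, hrs⟩ := (nhdsWithin_hasBasis Metric.nhds_basis_closedBall Sq).mem_iff.1 hev
  have hbox : Metric.closedBall p r ∩ Sq =
      Set.Icc ((p.1 - r, p.2 - r) ⊔ (-1, -1)) ((p.1 + r, p.2 + r) ⊓ (1, 1)) := by
    rw [Sq_eq_Icc, ← Set.Icc_inter_Icc, Set.Icc_prod_eq (p.1 - r, p.2 - r), ← Real.closedBall_eq_Icc,
      ← Real.closedBall_eq_Icc, closedBall_prod_same]
  refine ⟨_, _, hbox ▸ Set.inter_subset_right,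
    hbox ▸ ⟨Metric.mem_closedBall_self hr.le, hp⟩,
    hbox ▸ Filter.inter_mem (mem_nhdsWithin_of_mem_nhds (Metric.closedBall_mem_nhds p hr))
      self_mem_nhdsWithin, (2 * (K : ℝ))⁻¹, by positivity, ?_⟩
  rw [← hbox]
  intro x hx y hy
  have hconv : Convex ℝ (Metric.closedBall p r ∩ Sq) :=
    (convex_closedBall p r).inter ((convex_Icc _ _).prod (convex_Icc _ _))
  have hmv := hconv.norm_image_sub_le_of_norm_hasFDerivWithin_le'
    (f := gradSq φ) (f' := fderivWithin ℝ (gradSq φ) Sq) (φ := D)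
    (fun z hz => ((hg.differentiableOn (by norm_num) z hz.2).hasFDerivWithinAt).mono
      Set.inter_subset_right) (fun z hz => hrs hz) hy hx
  have hanti := hKD.le_mul_dist x y
  rw [dist_eq_norm, dist_eq_norm] at hanti
  simp only [ContinuousLinearMap.coe_coe] at hanti
  rw [← map_sub] at hanti
  have htri : ‖D (x - y)‖ ≤ ‖gradSq φ x - gradSq φ y‖ +
      ‖gradSq φ x - gradSq φ y - D (x - y)‖ := by
    have := norm_sub_norm_le (D (x - y)) (gradSq φ x - gradSq φ y)
    rw [norm_sub_rev (D (x - y))] at this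
    linarith
  have hlow : (K : ℝ)⁻¹ * ‖x - y‖ ≤ ‖D (x - y)‖ := by
    rw [inv_mul_le_iff₀ hK']
    exact hanti
  have : (K : ℝ)⁻¹ = (2 * (K : ℝ))⁻¹ + (2 * (K : ℝ))⁻¹ := by field_simp; norm_num
  rw [this, add_mul] at hlow
  linarith

/-- Uniform decay of the oscillatory integrals `∫ e(ξ·x + τ φ(x))` over a box on which the gradient
of `φ` is antilipschitz. -/
theorem exists_oscillatory_bound {φ : ℝ × ℝ → ℝ} (hφ : ContDiffOn ℝ 2 φ Sq) {a b p : ℝ × ℝ}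
    (hsub : Set.Icc a b ⊆ Sq) (hp : p ∈ Set.Icc a b) {c₀ : ℝ} (hc₀ : 0 < c₀)
    (hanti : ∀ x ∈ Set.Icc a b, ∀ y ∈ Set.Icc a b,
      c₀ * ‖x - y‖ ≤ ‖gradSq φ x - gradSq φ y‖) :
    ∃ C, 0 ≤ C ∧ ∀ (ξ : ℝ × ℝ) (τ : ℝ), 1 ≤ max ‖ξ‖ |τ| →
      ‖∫ x in Set.Icc a b, e (ξ.1 * x.1 + ξ.2 * x.2 + τ * φ x)‖ ≤
        C * (Real.log (1 + 2 * √(max ‖ξ‖ |τ|)) ^ 2 / max ‖ξ‖ |τ|) := by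
  have hg := contDiffOn_gradSq hφ
  have hgc := hg.continuousOn
  have hg'c := hg.continuousOn_fderivWithin uniqueDiffOn_Sq le_rfl
  obtain ⟨B₁, hB₁⟩ := isCompact_Sq.exists_bound_of_continuousOn hgc
  obtain ⟨B₂, hB₂⟩ := isCompact_Sq.exists_bound_of_continuousOn hg'c
  set B := max 1 (max B₁ B₂) with hB
  have hB1 : 1 ≤ B := le_max_left _ _
  have hBg : ∀ x ∈ Sq, ‖gradSq φ x‖ ≤ B := fun x hx =>
    (hB₁ x hx).trans ((le_max_left _ _).trans (le_max_right _ _))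
  have hBg' : ∀ x ∈ Sq, ‖fderivWithin ℝ (gradSq φ) Sq x‖ ≤ B := fun x hx =>
    (hB₂ x hx).trans ((le_max_right _ _).trans (le_max_right _ _))
  have hab : a ≤ b := hp.1.trans hp.2
  have haSq : a ∈ Sq := hsub ⟨le_rfl, hab⟩
  have hbSq : b ∈ Sq := hsub ⟨hab, le_rfl⟩
  have hdiam : ∀ x ∈ Set.Icc a b, ∀ y ∈ Set.Icc a b, ‖x - y‖ ≤ 2 := by
    intro x hx y hy
    obtain ⟨⟨h1, h2⟩, h3, h4⟩ := hsub hx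
    obtain ⟨⟨h5, h6⟩, h7, h8⟩ := hsub hy
    rw [Prod.norm_def, max_le_iff]
    constructor <;> rw [Real.norm_eq_abs, abs_le] <;> constructor <;>
      simp only [Prod.fst_sub, Prod.snd_sub] <;> linarith
  set c := min (1 / 4) (c₀ / (4 * B)) with hc
  have hcpos : 0 < c := lt_min (by norm_num) (by positivity)
  have hc4 : c ≤ 1 / 4 := min_le_left _ _
  have hcB : c * (4 * B) ≤ c₀ := (le_div_iff₀ (by positivity)).1 (min_le_right _ _)
  refine ⟨(48 * B + 64) / c ^ 2, by positivity, fun ξ τ hl => ?_⟩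
  set l := max ‖ξ‖ |τ| with hldef
  have hGc : ContinuousOn (fun x => ξ + τ • gradSq φ x) (Set.Icc a b) :=
    continuousOn_const.add ((hgc.mono hsub).const_smul τ)
  obtain ⟨x₀, hx₀, hmin⟩ := isCompact_Icc.exists_isMinOn ⟨p, hp⟩ hGc.norm
  have hnhds : ∀ x ∈ Set.Ioo a.1 b.1 ×ˢ Set.Ioo a.2 b.2, Sq ∈ nhds x := by
    intro x hx
    refine Filter.mem_of_superset ((isOpen_Ioo.prod isOpen_Ioo).mem_nhds hx) ?_
    refine (Set.prod_mono Set.Ioo_subset_Icc_self Set.Ioo_subset_Icc_self).trans ?_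
    rwa [← Set.Icc_prod_eq]
  refine norm_integral_e_le (G := fun x => ξ + τ • gradSq φ x)
    (H := fun x => τ • fderivWithin ℝ (gradSq φ) Sq x) hx₀ ?_ ?_ (by linarith) hcpos
    (by linarith) hl ?_ hGc ((hg'c.mono hsub).const_smul τ) ?_ ?_ ?_ ?_
  · linarith [hbSq.1.2, haSq.1.1]
  · linarith [hbSq.2.2, haSq.2.1]
  · exact Continuous.continuousOn (by fun_prop) |>.add
      (continuousOn_const.mul (hφ.continuousOn.mono hsub))
  · intro x hx
    have h := (((hasFDerivAt_fst (𝕜 := ℝ) (p := x)).const_mul ξ.1).add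
      ((hasFDerivAt_snd (𝕜 := ℝ) (p := x)).const_mul ξ.2)).add
      ((hasFDerivAt_of_gradSq hφ (hnhds x hx)).const_mul τ)
    refine h.congr_fderiv ?_
    ext <;> simp
  · intro x hx
    have h := ((hg.differentiableOn (by norm_num)) x
      (mem_of_mem_nhds (hnhds x hx))).hasFDerivWithinAt.hasFDerivAt (hnhds x hx)
    exact (h.const_smul τ).const_add ξ
  · intro x hx
    rw [norm_smul, mul_comm, Real.norm_eq_abs]
    exact mul_le_mul (hBg' x (hsub hx)) (le_max_right _ _) (abs_nonneg _) (by linarith)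
  · intro x hx
    have hgx := hBg x (hsub hx)
    rcases le_total (2 * B * |τ|) ‖ξ‖ with h | h
    · have hτ : |τ| ≤ ‖ξ‖ := by nlinarith [abs_nonneg τ]
      have hl' : l = ‖ξ‖ := max_eq_left hτ
      have h1 : ‖ξ‖ ≤ ‖ξ + τ • gradSq φ x‖ + |τ| * B := by
        calc ‖ξ‖ = ‖(ξ + τ • gradSq φ x) - τ • gradSq φ x‖ := by rw [add_sub_cancel_right]
          _ ≤ ‖ξ + τ • gradSq φ x‖ + ‖τ • gradSq φ x‖ := norm_sub_le _ _
          _ ≤ _ := by rw [norm_smul, Real.norm_eq_abs]; gcongr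
      have h2 : c * l * ‖x - x₀‖ ≤ 1 / 4 * l * 2 := by
        gcongr
        exact hdiam x hx x₀ hx₀
      rw [hl'] at h2 ⊢
      linarith
    · have hl' : l ≤ 2 * B * |τ| := max_le h (by nlinarith [abs_nonneg τ])
      have h1 : ‖ξ + τ • gradSq φ x₀‖ ≤ ‖ξ + τ • gradSq φ x‖ := hmin hx
      have h2 : |τ| * ‖gradSq φ x - gradSq φ x₀‖ ≤
          ‖ξ + τ • gradSq φ x‖ + ‖ξ + τ • gradSq φ x₀‖ := by
        calc |τ| * ‖gradSq φ x - gradSq φ x₀‖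
            = ‖(ξ + τ • gradSq φ x) - (ξ + τ • gradSq φ x₀)‖ := by
              rw [add_sub_add_left_eq_sub, ← smul_sub, norm_smul, Real.norm_eq_abs]
          _ ≤ _ := norm_sub_le _ _
      have h3 : |τ| * (c₀ * ‖x - x₀‖) ≤ |τ| * ‖gradSq φ x - gradSq φ x₀‖ := by
        gcongr
        exact hanti x hx x₀ hx₀
      have h4 : c * l * ‖x - x₀‖ ≤ c * (2 * B * |τ|) * ‖x - x₀‖ := by gcongr
      have h5 : c * (4 * B) * (|τ| * ‖x - x₀‖) ≤ c₀ * (|τ| * ‖x - x₀‖) := by gcongr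
      linarith

theorem sum_le_of_fiber_card_le {ι : Type*} (s : Finset ι) (F : ι → ℝ) (g : ι → ℕ) (f : ℕ → ℝ)
    (K c : ℕ) (hf : ∀ k, 0 ≤ f k) (hg : ∀ i ∈ s, g i ≤ K) (hF : ∀ i ∈ s, F i ≤ f (g i))
    (hc : ∀ k, (s.filter fun i => g i = k).card ≤ c) :
    ∑ i ∈ s, F i ≤ c * (f 0 + ∑ k ∈ Finset.range K, f (k + 1)) := by
  have hmaps : ∀ i ∈ s, g i ∈ Finset.range (K + 1) := fun i hi =>
    Finset.mem_range.2 (Nat.lt_succ_of_le (hg i hi))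
  calc ∑ i ∈ s, F i ≤ ∑ i ∈ s, f (g i) := Finset.sum_le_sum hF
    _ = ∑ k ∈ Finset.range (K + 1), ∑ i ∈ s with g i = k, f (g i) :=
        (Finset.sum_fiberwise_of_maps_to hmaps _).symm
    _ ≤ ∑ k ∈ Finset.range (K + 1), c * f k := by
        refine Finset.sum_le_sum fun k _ => ?_
        rw [Finset.sum_congr rfl (g := fun _ => f k)
          (fun i hi => by rw [(Finset.mem_filter.1 hi).2]), Finset.sum_const, nsmul_eq_mul]
        exact mul_le_mul_of_nonneg_right (by exact_mod_cast hc k) (hf k)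
    _ = c * (f 0 + ∑ k ∈ Finset.range K, f (k + 1)) := by
        rw [← Finset.mul_sum, Finset.sum_range_succ']; ring

theorem sum_range_inv_le {n : ℕ} : ∑ k ∈ Finset.range n, ((k : ℝ) + 1)⁻¹ ≤ 1 + Real.log n := by
  have h := harmonic_le_one_add_log n
  simpa [harmonic] using h

theorem one_le_two_mul_log {N : ℕ} (hN : 2 ≤ N) : 1 ≤ 3 / 2 * Real.log N := by
  have h1 : Real.log 2 ≤ Real.log N := Real.log_le_log (by norm_num) (by exact_mod_cast hN)
  linarith [Real.log_two_gt_d9]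

theorem sum_range_inv_le_log {N n : ℕ} (hN : 2 ≤ N) (hn : n ≤ 2 * N ^ 2) :
    ∑ k ∈ Finset.range n, ((k : ℝ) + 1)⁻¹ ≤ 5 * Real.log N := by
  have hN' : (2 : ℝ) ≤ N := by exact_mod_cast hN
  have h0 : ∑ k ∈ Finset.range n, ((k : ℝ) + 1)⁻¹ ≤
      ∑ k ∈ Finset.range (2 * N ^ 2), ((k : ℝ) + 1)⁻¹ :=
    Finset.sum_le_sum_of_subset_of_nonneg (Finset.range_subset_range.2 hn)
      fun k _ _ => by positivity
  have h1 : Real.log ((2 * N ^ 2 : ℕ) : ℝ) ≤ 3 * Real.log N := by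
    rw [show (3 : ℝ) * Real.log N = Real.log ((N : ℝ) ^ 3) by rw [Real.log_pow]; norm_num]
    refine Real.log_le_log (by positivity) ?_
    push_cast
    nlinarith [sq_nonneg (N : ℝ)]
  linarith [@sum_range_inv_le (2 * N ^ 2), one_le_two_mul_log hN]

theorem sum_inv_max_abs_sub_le {N : ℕ} (hN : 2 ≤ N) {c : ℤ} (hc : |c| ≤ N) :
    ∑ x ∈ Finset.Icc (-(N : ℤ)) N, ((max |x - c| 1 : ℤ) : ℝ)⁻¹ ≤ 13 * Real.log N := by
  have h := sum_le_of_fiber_card_le (Finset.Icc (-(N : ℤ)) N)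
    (fun x => ((max |x - c| 1 : ℤ) : ℝ)⁻¹) (fun x => (x - c).natAbs)
    (fun k => (max (k : ℝ) 1)⁻¹) (2 * N) 2 (fun k => by positivity)
    (fun x hx => by
      rw [Finset.mem_Icc] at hx
      rw [abs_le] at hc
      show (x - c).natAbs ≤ 2 * N
      omega)
    (fun x _ => by
      rw [Int.cast_max, Int.cast_one, Nat.cast_natAbs])
    (fun k => by
      have hsub : ((Finset.Icc (-(N : ℤ)) N).filter fun x => (x - c).natAbs = k) ⊆
          {c + k, c - k} := by
        intro x hx
        rw [Finset.mem_filter] at hx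
        rw [Finset.mem_insert, Finset.mem_singleton]
        omega
      exact (Finset.card_le_card hsub).trans Finset.card_le_two)
  have h2 : ∑ k ∈ Finset.range (2 * N), (max ((k + 1 : ℕ) : ℝ) 1)⁻¹ ≤ 5 * Real.log N := by
    refine le_trans (le_of_eq (Finset.sum_congr rfl fun k _ => ?_))
      (sum_range_inv_le_log hN (n := 2 * N) (by nlinarith))
    rw [max_eq_left (by push_cast; linarith [Nat.cast_nonneg (α := ℝ) k])]
    push_cast; rfl
  have h3 := one_le_two_mul_log hN
  norm_num at h h2 ⊢
  linarith

theorem sum_inv_max_row_le {N : ℕ} (hN : 2 ≤ N) {x d R : ℤ} (hx : |x| ≤ N) (hR : 0 ≤ R)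
    (hR' : R ≤ 2 * N ^ 2) :
    ∑ y ∈ Finset.Icc (-(N : ℤ)) N with max |x| 1 ≤ |y|,
        ((max (max d |x ^ 2 + y ^ 2 - R|) 1 : ℤ) : ℝ)⁻¹ ≤
      4 * (((max d 1 : ℤ) : ℝ)⁻¹ + 5 * Real.log N * ((max |x| 1 : ℤ) : ℝ)⁻¹) := by
  set m : ℕ := max x.natAbs 1 with hm
  have hmZ : max |x| 1 = (m : ℤ) := by rw [hm]; push_cast; rw [Int.abs_eq_natAbs]
  have hm1 : 1 ≤ m := le_max_right _ _
  have hm0 : (0 : ℝ) < m := by exact_mod_cast hm1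
  rw [hmZ]
  have hd0 : (0 : ℝ) < ((max d 1 : ℤ) : ℝ) := by
    exact_mod_cast lt_of_lt_of_le one_pos (le_max_right d 1)
  have h := sum_le_of_fiber_card_le ((Finset.Icc (-(N : ℤ)) N).filter fun y => (m : ℤ) ≤ |y|)
    (fun y => ((max (max d |x ^ 2 + y ^ 2 - R|) 1 : ℤ) : ℝ)⁻¹)
    (fun y => (x ^ 2 + y ^ 2 - R).natAbs / m)
    (fun k => if k = 0 then ((max d 1 : ℤ) : ℝ)⁻¹ else ((m : ℝ) * k)⁻¹) (2 * N ^ 2) 4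
    (fun k => by
      show 0 ≤ ite _ _ _
      split_ifs <;> positivity)
    (fun y hy => by
      rw [Finset.mem_filter, Finset.mem_Icc] at hy
      have hx2 : x ^ 2 ≤ (N : ℤ) ^ 2 := sq_le_sq' (abs_le.1 hx).1 (abs_le.1 hx).2
      have hy2 : y ^ 2 ≤ (N : ℤ) ^ 2 := sq_le_sq' hy.1.1 hy.1.2
      refine (Nat.div_le_self _ _).trans ?_
      have := sq_nonneg x
      have := sq_nonneg y
      zify
      rw [abs_le]
      constructor <;> linarith)
    (fun y _ => by
      show _ ≤ ite _ _ _
      split_ifs with hk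
      · refine inv_anti₀ hd0 ?_
        exact_mod_cast max_le_max_right _ (le_max_left _ _)
      · refine inv_anti₀ (by positivity) ?_
        have h1 : m * ((x ^ 2 + y ^ 2 - R).natAbs / m) ≤ (x ^ 2 + y ^ 2 - R).natAbs :=
          Nat.mul_div_le _ _
        have h2 : ((m * ((x ^ 2 + y ^ 2 - R).natAbs / m) : ℕ) : ℤ) ≤ |x ^ 2 + y ^ 2 - R| := by
          rw [Int.abs_eq_natAbs]; exact_mod_cast h1
        have h3 : _ ≤ max (max d |x ^ 2 + y ^ 2 - R|) 1 :=
          h2.trans ((le_max_right _ _).trans (le_max_left _ _))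
        rw [← Nat.cast_mul, ← Int.cast_natCast]
        exact Int.cast_le.2 h3)
    (fun k => by
      refine le_trans (Finset.card_le_card_of_injOn
        (t := (Finset.univ : Finset (Bool × Bool)))
        (fun y => (decide (0 ≤ y), decide (0 ≤ x ^ 2 + y ^ 2 - R)))
        (fun _ _ => Finset.mem_univ _) ?_) (by decide)
      intro y hy z hz hyz
      rw [Finset.mem_coe, Finset.mem_filter, Finset.mem_filter, Finset.mem_Icc] at hy hz
      simp only [Prod.mk.injEq, decide_eq_decide] at hyz
      obtain ⟨⟨-, hy1⟩, hy2⟩ := hy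
      obtain ⟨⟨-, hz1⟩, hz2⟩ := hz
      have hmpos : 0 < m := hm1
      have e1 := Nat.div_add_mod (x ^ 2 + y ^ 2 - R).natAbs m
      have e2 := Nat.div_add_mod (x ^ 2 + z ^ 2 - R).natAbs m
      have l1 := Nat.mod_lt (x ^ 2 + y ^ 2 - R).natAbs hmpos
      have l2 := Nat.mod_lt (x ^ 2 + z ^ 2 - R).natAbs hmpos
      rw [hy2] at e1
      rw [hz2] at e2
      have hlt : |y ^ 2 - z ^ 2| < m := by
        rw [abs_lt]
        generalize y ^ 2 = u at *
        generalize z ^ 2 = v at *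
        generalize x ^ 2 = w at *
        generalize m * k = q at *
        omega
      by_contra hne
      have h1 : 1 ≤ |y - z| := Int.one_le_abs (sub_ne_zero.2 hne)
      have h2 : (m : ℤ) ≤ |y + z| := by
        generalize (x ^ 2 + y ^ 2 - R) = u at *
        generalize (x ^ 2 + z ^ 2 - R) = v at *
        rcases abs_cases y with h | h <;> rcases abs_cases z with h' | h' <;>
          rcases abs_cases (y + z) with h'' | h'' <;> omega
      have h3 : |y ^ 2 - z ^ 2| = |y - z| * |y + z| := by rw [← abs_mul]; congr 1; ring
      nlinarith [abs_nonneg (y + z)])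
  refine h.trans ?_
  have hs : ∑ k ∈ Finset.range (2 * N ^ 2), ((m : ℝ) * ((k + 1 : ℕ) : ℝ))⁻¹ ≤
      5 * Real.log N * (m : ℝ)⁻¹ := by
    have := sum_range_inv_le_log hN (le_refl (2 * N ^ 2))
    calc _ = (m : ℝ)⁻¹ * ∑ k ∈ Finset.range (2 * N ^ 2), ((k : ℝ) + 1)⁻¹ := by
          rw [Finset.mul_sum]
          refine Finset.sum_congr rfl fun k _ => ?_
          rw [mul_inv]; push_cast; rfl
      _ ≤ (m : ℝ)⁻¹ * (5 * Real.log N) := by gcongr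
      _ = _ := by ring
  simp only [if_true, Nat.add_eq_zero_iff, one_ne_zero, and_false, if_false]
  push_cast at hs ⊢
  linarith

theorem sum_inv_max_half_le {N : ℕ} (hN : 2 ≤ N) {c R : ℤ} (hc : |c| ≤ N) (hR : 0 ≤ R)
    (hR' : R ≤ 2 * N ^ 2) :
    ∑ x ∈ Finset.Icc (-(N : ℤ)) N, ∑ y ∈ Finset.Icc (-(N : ℤ)) N with max |x| 1 ≤ |y|,
        ((max (max |x - c| |x ^ 2 + y ^ 2 - R|) 1 : ℤ) : ℝ)⁻¹ ≤ 340 * Real.log N ^ 2 := by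
  have h1 := sum_inv_max_abs_sub_le hN hc
  have h2 := sum_inv_max_abs_sub_le hN (c := 0) (by simp)
  have h3 := one_le_two_mul_log hN
  simp only [sub_zero] at h2
  calc _ ≤ ∑ x ∈ Finset.Icc (-(N : ℤ)) N, 4 * (((max |x - c| 1 : ℤ) : ℝ)⁻¹ +
        5 * Real.log N * ((max |x| 1 : ℤ) : ℝ)⁻¹) := by
        refine Finset.sum_le_sum fun x hx => sum_inv_max_row_le hN ?_ hR hR'
        rw [Finset.mem_Icc] at hx
        exact abs_le.2 hx
    _ = 4 * (∑ x ∈ Finset.Icc (-(N : ℤ)) N, ((max |x - c| 1 : ℤ) : ℝ)⁻¹ +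
        5 * Real.log N * ∑ x ∈ Finset.Icc (-(N : ℤ)) N, ((max |x| 1 : ℤ) : ℝ)⁻¹) := by
        rw [← Finset.mul_sum, Finset.sum_add_distrib, ← Finset.mul_sum]
    _ ≤ 4 * (13 * Real.log N + 5 * Real.log N * (13 * Real.log N)) := by
        gcongr
    _ ≤ 340 * Real.log N ^ 2 := by nlinarith

/-- The size of the frequency difference of the terms with indices `p` and `q`, at least `1`. -/
noncomputable def freqGap (p q : ℤ × ℤ) : ℤ :=
  max (max (max |p.1 - q.1| |p.2 - q.2|) |p.1 ^ 2 + p.2 ^ 2 - (q.1 ^ 2 + q.2 ^ 2)|) 1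

theorem freqGap_comm (p q : ℤ × ℤ) : freqGap p q = freqGap q p := by
  simp only [freqGap, abs_sub_comm]

/-- The index box `[-N,N]²`. -/
noncomputable def freqBox (N : ℕ) : Finset (ℤ × ℤ) :=
  Finset.Icc (-(N : ℤ)) N ×ˢ Finset.Icc (-(N : ℤ)) N

theorem sum_inv_freqGap_le {N : ℕ} (hN : 2 ≤ N) {q : ℤ × ℤ} (hq : q ∈ freqBox N) :
    ∑ p ∈ freqBox N, ((freqGap p q : ℤ) : ℝ)⁻¹ ≤ 700 * Real.log N ^ 2 := by
  obtain ⟨c, c'⟩ := q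
  simp only [freqBox, Finset.mem_product, Finset.mem_Icc] at hq
  have hc : |c| ≤ N := abs_le.2 hq.1
  have hc' : |c'| ≤ N := abs_le.2 hq.2
  have hR : 0 ≤ c ^ 2 + c' ^ 2 := by positivity
  have hR' : c ^ 2 + c' ^ 2 ≤ 2 * (N : ℤ) ^ 2 := by
    linarith [sq_le_sq' hq.1.1 hq.1.2, sq_le_sq' hq.2.1 hq.2.2]
  have h1 := sum_inv_max_half_le hN hc hR hR'
  have h2 := sum_inv_max_half_le hN hc' hR hR'
  have h3 := one_le_two_mul_log hN
  have hpos : ∀ z : ℤ, (0 : ℝ) < ((max z 1 : ℤ) : ℝ) := fun z => by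
    exact_mod_cast lt_of_lt_of_le one_pos (le_max_right z 1)
  set R := c ^ 2 + c' ^ 2 with hRdef
  set I := Finset.Icc (-(N : ℤ)) N with hI
  simp only [Finset.sum_filter] at h1 h2
  rw [Finset.sum_comm] at h2
  have hpt : ∀ x y : ℤ, ((freqGap (x, y) (c, c') : ℤ) : ℝ)⁻¹ ≤
      (if x = 0 then (if y = 0 then 1 else 0) else 0) +
      ((if max |x| 1 ≤ |y| then ((max (max |x - c| |x ^ 2 + y ^ 2 - R|) 1 : ℤ) : ℝ)⁻¹ else 0) +
      (if max |y| 1 ≤ |x| then ((max (max |y - c'| |y ^ 2 + x ^ 2 - R|) 1 : ℤ) : ℝ)⁻¹ else 0)) := by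
    intro x y
    have n1 : (0 : ℝ) ≤ (if x = 0 then (if y = 0 then 1 else 0) else 0) := by
      split_ifs <;> norm_num
    have n2 : (0 : ℝ) ≤ (if max |x| 1 ≤ |y| then
        ((max (max |x - c| |x ^ 2 + y ^ 2 - R|) 1 : ℤ) : ℝ)⁻¹ else 0) := by
      split_ifs
      · exact (inv_pos.2 (hpos _)).le
      · exact le_rfl
    have n3 : (0 : ℝ) ≤ (if max |y| 1 ≤ |x| then
        ((max (max |y - c'| |y ^ 2 + x ^ 2 - R|) 1 : ℤ) : ℝ)⁻¹ else 0) := by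
      split_ifs
      · exact (inv_pos.2 (hpos _)).le
      · exact le_rfl
    by_cases hy : max |x| 1 ≤ |y|
    · refine le_trans ?_ (le_add_of_nonneg_left n1)
      refine le_trans ?_ (le_add_of_nonneg_right n3)
      rw [if_pos hy]
      refine inv_anti₀ (hpos _) (Int.cast_le.2 ?_)
      exact max_le_max_right _ (max_le_max_right _ (le_max_left _ _))
    by_cases hx : max |y| 1 ≤ |x|
    · refine le_trans ?_ (le_add_of_nonneg_left n1)
      refine le_trans ?_ (le_add_of_nonneg_left n2)
      rw [if_pos hx]
      refine inv_anti₀ (hpos _) (Int.cast_le.2 ?_)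
      rw [add_comm (y ^ 2)]
      exact max_le_max_right _ (max_le_max_right _ (le_max_right _ _))
    · have : x = 0 ∧ y = 0 := by
        rcases abs_cases x with h | h <;> rcases abs_cases y with h' | h' <;> omega
      obtain ⟨rfl, rfl⟩ := this
      refine le_trans ?_ (le_add_of_nonneg_right (add_nonneg n2 n3))
      rw [if_pos rfl, if_pos rfl]
      refine inv_le_one_of_one_le₀ ?_
      exact_mod_cast le_max_right _ (1 : ℤ)
  have h0 : (∑ x ∈ I, ∑ y ∈ I, if x = 0 then (if y = 0 then (1 : ℝ) else 0) else 0) ≤ 1 := by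
    simp only [Finset.sum_ite_irrel, Finset.sum_const_zero, Finset.sum_ite_eq']
    split_ifs <;> norm_num
  have hall := Finset.sum_le_sum fun x (_ : x ∈ I) => Finset.sum_le_sum fun y (_ : y ∈ I) => hpt x y
  simp only [Finset.sum_add_distrib] at hall
  rw [freqBox, Finset.sum_product]
  nlinarith

/-- The phase `nx + my + (n² + m²)φ(x,y)` for `p = (n, m)`. -/
noncomputable def phase (φ : ℝ × ℝ → ℝ) (p : ℤ × ℤ) (x : ℝ × ℝ) : ℝ :=
  (p.1 : ℝ) * x.1 + (p.2 : ℝ) * x.2 + ((p.1 : ℝ) ^ 2 + (p.2 : ℝ) ^ 2) * φ x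

theorem log_one_add_two_mul_sqrt_le {N : ℕ} (hN : 2 ≤ N) {M : ℝ} (hM : M ≤ 2 * N ^ 2) :
    Real.log (1 + 2 * √M) ≤ 3 * Real.log N := by
  have hN' : (2 : ℝ) ≤ N := by exact_mod_cast hN
  have h1 : √M ≤ 3 / 2 * N := Real.sqrt_le_iff.2 ⟨by positivity, by nlinarith⟩
  rw [show (3 : ℝ) * Real.log N = Real.log ((N : ℝ) ^ 3) by rw [Real.log_pow]; norm_num]
  refine Real.log_le_log (by positivity) ?_
  nlinarith [mul_nonneg (sub_nonneg.2 hN') (sub_nonneg.2 hN')]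

theorem exists_kernel_bound {φ : ℝ × ℝ → ℝ} {a b : ℝ × ℝ} {C : ℝ} (hC : 0 ≤ C)
    (hosc : ∀ (ξ : ℝ × ℝ) (τ : ℝ), 1 ≤ max ‖ξ‖ |τ| →
      ‖∫ x in Set.Icc a b, e (ξ.1 * x.1 + ξ.2 * x.2 + τ * φ x)‖ ≤
        C * (Real.log (1 + 2 * √(max ‖ξ‖ |τ|)) ^ 2 / max ‖ξ‖ |τ|)) :
    ∃ D, 0 ≤ D ∧ ∀ N : ℕ, 2 ≤ N → ∀ p ∈ freqBox N, ∀ q ∈ freqBox N,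
      ‖∫ x in Set.Icc a b, e (phase φ p x - phase φ q x)‖ ≤
        D * Real.log N ^ 2 * ((freqGap p q : ℤ) : ℝ)⁻¹ := by
  set V := volume.real (Set.Icc a b) with hV
  have hV0 : 0 ≤ V := measureReal_nonneg
  refine ⟨9 * C + 9 / 4 * V, by positivity, fun N hN p hp q hq => ?_⟩
  have hL := one_le_two_mul_log hN
  set ξ : ℝ × ℝ := ((p.1 : ℝ) - q.1, (p.2 : ℝ) - q.2) with hξ
  set τ : ℝ := (p.1 : ℝ) ^ 2 + (p.2 : ℝ) ^ 2 - ((q.1 : ℝ) ^ 2 + (q.2 : ℝ) ^ 2) with hτ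
  have hphase : ∀ x, phase φ p x - phase φ q x = ξ.1 * x.1 + ξ.2 * x.2 + τ * φ x := fun x => by
    simp only [phase, hξ, hτ]; ring
  simp only [hphase]
  have hgap : ((freqGap p q : ℤ) : ℝ) = max (max ‖ξ‖ |τ|) 1 := by
    simp only [freqGap, hξ, hτ, Prod.norm_def, Real.norm_eq_abs]
    push_cast
    rfl
  rw [hgap]
  have hN' : (2 : ℝ) ≤ N := by exact_mod_cast hN
  rcases le_or_gt 1 (max ‖ξ‖ |τ|) with hM | hM
  · rw [max_eq_left hM]
    refine (hosc ξ τ hM).trans ?_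
    have hM2 : max ‖ξ‖ |τ| ≤ 2 * (N : ℝ) ^ 2 := by
      simp only [freqBox, Finset.mem_product, Finset.mem_Icc] at hp hq
      obtain ⟨⟨p1, p2⟩, p3, p4⟩ := hp
      obtain ⟨⟨q1, q2⟩, q3, q4⟩ := hq
      have c : ∀ z : ℤ, -(N : ℤ) ≤ z → z ≤ N → -(N : ℝ) ≤ z ∧ (z : ℝ) ≤ N := fun z h h' =>
        ⟨by exact_mod_cast h, by exact_mod_cast h'⟩
      have p12 := c _ p1 p2
      have p34 := c _ p3 p4
      have q12 := c _ q1 q2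
      have q34 := c _ q3 q4
      have sp1 := sq_le_sq' p12.1 p12.2
      have sp2 := sq_le_sq' p34.1 p34.2
      have sq1 := sq_le_sq' q12.1 q12.2
      have sq2 := sq_le_sq' q34.1 q34.2
      rw [hξ, Prod.norm_def, Real.norm_eq_abs, Real.norm_eq_abs]
      refine max_le (max_le ?_ ?_) ?_
      · rw [abs_le]; constructor <;> nlinarith
      · rw [abs_le]; constructor <;> nlinarith
      · rw [hτ, abs_le]
        constructor <;>
          linarith [sq_nonneg (p.1 : ℝ), sq_nonneg (p.2 : ℝ), sq_nonneg (q.1 : ℝ),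
            sq_nonneg (q.2 : ℝ)]
    have hlog := log_one_add_two_mul_sqrt_le hN hM2
    have hlog0 : 0 ≤ Real.log (1 + 2 * √(max ‖ξ‖ |τ|)) :=
      Real.log_nonneg (by linarith [Real.sqrt_nonneg (max ‖ξ‖ |τ|)])
    have hMpos : 0 < (max ‖ξ‖ |τ|)⁻¹ := inv_pos.2 (by linarith)
    rw [div_eq_mul_inv, ← mul_assoc]
    refine mul_le_mul_of_nonneg_right ?_ hMpos.le
    calc C * Real.log (1 + 2 * √(max ‖ξ‖ |τ|)) ^ 2 ≤ C * (3 * Real.log N) ^ 2 := by gcongr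
      _ ≤ (9 * C + 9 / 4 * V) * Real.log N ^ 2 := by
        nlinarith [mul_nonneg hV0 (sq_nonneg (Real.log N))]
  · rw [max_eq_right hM.le, inv_one, mul_one]
    have h1 : ‖∫ x in Set.Icc a b, e (ξ.1 * x.1 + ξ.2 * x.2 + τ * φ x)‖ ≤ 1 * V :=
      norm_setIntegral_le_of_norm_le_const isCompact_Icc.measure_lt_top
        fun x _ => (norm_e _).le
    have h2 : 1 ≤ 9 / 4 * Real.log N ^ 2 := by nlinarith
    nlinarith [mul_nonneg hC (sq_nonneg (Real.log N))]

theorem sum_sum_mul_le_of_row_sum_le {ι : Type*} (s : Finset ι) (w : ι → ι → ℝ) (u : ι → ℝ)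
    {B : ℝ} (hw : ∀ p q, 0 ≤ w p q) (hsymm : ∀ p q, w p q = w q p)
    (hB : ∀ q ∈ s, ∑ p ∈ s, w p q ≤ B) :
    ∑ p ∈ s, ∑ q ∈ s, u p * u q * w p q ≤ B * ∑ p ∈ s, u p ^ 2 := by
  have h1 : ∑ p ∈ s, ∑ q ∈ s, u q ^ 2 * w p q ≤ B * ∑ p ∈ s, u p ^ 2 := by
    rw [Finset.sum_comm, Finset.mul_sum]
    refine Finset.sum_le_sum fun q hq => ?_
    rw [← Finset.mul_sum, mul_comm]
    exact mul_le_mul_of_nonneg_right (hB q hq) (sq_nonneg _)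
  have h2 : ∑ p ∈ s, ∑ q ∈ s, u p ^ 2 * w p q ≤ B * ∑ p ∈ s, u p ^ 2 := by
    rw [Finset.sum_comm]
    simpa only [hsymm] using h1
  have h3 : ∑ p ∈ s, ∑ q ∈ s, u p * u q * w p q ≤
      ∑ p ∈ s, ∑ q ∈ s, (u p ^ 2 * w p q + u q ^ 2 * w p q) / 2 :=
    Finset.sum_le_sum fun p _ => Finset.sum_le_sum fun q _ => by
      nlinarith [mul_nonneg (sq_nonneg (u p - u q)) (hw p q)]
  simp only [← Finset.sum_div, Finset.sum_add_distrib] at h3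
  linarith

theorem e_mul_conj_e (s t : ℝ) : e s * (starRingEnd ℂ) (e t) = e (s - t) := by
  simp only [e]
  rw [← Complex.exp_conj, ← Complex.exp_add]
  congr 1
  simp only [map_mul, Complex.conj_ofReal, Complex.conj_I, map_ofNat, Complex.ofReal_sub]
  ring

/-- The exponential sum with coefficients `c`. -/
noncomputable def expSum (φ : ℝ × ℝ → ℝ) (N : ℕ) (c : ℤ × ℤ → ℂ) (x : ℝ × ℝ) : ℂ :=
  ∑ p ∈ freqBox N, c p * e (phase φ p x)

theorem continuousOn_phase {φ : ℝ × ℝ → ℝ} {s : Set (ℝ × ℝ)} (hφ : ContinuousOn φ s) (p : ℤ × ℤ) :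
    ContinuousOn (phase φ p) s := by
  unfold phase
  fun_prop

theorem exists_local_bound {φ : ℝ × ℝ → ℝ} {a b : ℝ × ℝ} (hφ : ContinuousOn φ (Set.Icc a b))
    {D : ℝ} (hD : 0 ≤ D) {N : ℕ} (hN : 2 ≤ N)
    (hK : ∀ p ∈ freqBox N, ∀ q ∈ freqBox N,
      ‖∫ x in Set.Icc a b, e (phase φ p x - phase φ q x)‖ ≤
        D * Real.log N ^ 2 * ((freqGap p q : ℤ) : ℝ)⁻¹) (c : ℤ × ℤ → ℂ) :
    ∫⁻ x in Set.Icc a b, ‖expSum φ N c x‖ₑ ^ 2 ≤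
      ENNReal.ofReal (700 * D * Real.log N ^ 4 * ∑ p ∈ freqBox N, ‖c p‖ ^ 2) := by
  have hcont : ContinuousOn (expSum φ N c) (Set.Icc a b) := by
    unfold expSum
    refine continuousOn_finsetSum _ fun p _ => continuousOn_const.mul ?_
    exact continuous_e.comp_continuousOn (continuousOn_phase hφ p)
  have hint : IntegrableOn (fun x => ‖expSum φ N c x‖ ^ 2) (Set.Icc a b) :=
    (hcont.norm.pow 2).integrableOn_compact isCompact_Icc
  have hexp : ∀ x, ((‖expSum φ N c x‖ ^ 2 : ℝ) : ℂ) = ∑ p ∈ freqBox N, ∑ q ∈ freqBox N,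
      c p * (starRingEnd ℂ) (c q) * e (phase φ p x - phase φ q x) := fun x => by
    rw [Complex.ofReal_pow, ← Complex.mul_conj', expSum, map_sum, Finset.sum_mul_sum]
    refine Finset.sum_congr rfl fun p _ => Finset.sum_congr rfl fun q _ => ?_
    rw [← e_mul_conj_e, map_mul]
    ring
  have hi : ∀ p q : ℤ × ℤ, IntegrableOn (fun x => c p * (starRingEnd ℂ) (c q) *
      e (phase φ p x - phase φ q x)) (Set.Icc a b) := fun p q =>
    (continuousOn_const.mul (continuous_e.comp_continuousOn
      ((continuousOn_phase hφ p).sub (continuousOn_phase hφ q)))).integrableOn_compact isCompact_Icc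
  have hmain : ((∫ x in Set.Icc a b, ‖expSum φ N c x‖ ^ 2 : ℝ) : ℂ) =
      ∑ p ∈ freqBox N, ∑ q ∈ freqBox N, c p * (starRingEnd ℂ) (c q) *
        ∫ x in Set.Icc a b, e (phase φ p x - phase φ q x) := by
    rw [← integral_complex_ofReal]
    simp only [hexp]
    rw [integral_finsetSum _ fun p _ => integrable_finsetSum _ fun q _ => hi p q]
    refine Finset.sum_congr rfl fun p _ => ?_
    rw [integral_finsetSum _ fun q _ => hi p q]
    exact Finset.sum_congr rfl fun q _ => integral_const_mul _ _
  have hle : ∫ x in Set.Icc a b, ‖expSum φ N c x‖ ^ 2 ≤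
      700 * D * Real.log N ^ 4 * ∑ p ∈ freqBox N, ‖c p‖ ^ 2 := by
    have hgap : ∀ p q : ℤ × ℤ, (0 : ℝ) ≤ ((freqGap p q : ℤ) : ℝ)⁻¹ := fun p q => by
      have : (0 : ℤ) ≤ freqGap p q := le_trans zero_le_one (le_max_right _ _)
      exact inv_nonneg.2 (by exact_mod_cast this)
    have hrow := sum_sum_mul_le_of_row_sum_le (freqBox N)
      (fun p q => D * Real.log N ^ 2 * ((freqGap p q : ℤ) : ℝ)⁻¹) (fun p => ‖c p‖)
      (B := D * Real.log N ^ 2 * (700 * Real.log N ^ 2))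
      (fun p q => mul_nonneg (by positivity) (hgap p q))
      (fun p q => by simp only [freqGap_comm p q])
      (fun q hq => by
        rw [← Finset.mul_sum]
        exact mul_le_mul_of_nonneg_left (sum_inv_freqGap_le hN hq) (by positivity))
    calc _ ≤ ‖((∫ x in Set.Icc a b, ‖expSum φ N c x‖ ^ 2 : ℝ) : ℂ)‖ := by
          rw [Complex.norm_real]; exact Real.le_norm_self _
      _ ≤ ∑ p ∈ freqBox N, ∑ q ∈ freqBox N, ‖c p‖ * ‖c q‖ *
            (D * Real.log N ^ 2 * ((freqGap p q : ℤ) : ℝ)⁻¹) := by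
          rw [hmain]
          refine norm_sum_le_of_le _ fun p hp => norm_sum_le_of_le _ fun q hq => ?_
          rw [norm_mul, norm_mul, RCLike.norm_conj]
          exact mul_le_mul_of_nonneg_left (hK p hp q hq) (by positivity)
      _ ≤ _ := hrow
      _ = _ := by ring
  calc ∫⁻ x in Set.Icc a b, ‖expSum φ N c x‖ₑ ^ 2
      = ∫⁻ x in Set.Icc a b, ENNReal.ofReal (‖expSum φ N c x‖ ^ 2) := by
        refine lintegral_congr fun x => ?_
        rw [ENNReal.ofReal_pow (norm_nonneg _), ofReal_norm]
    _ = ENNReal.ofReal (∫ x in Set.Icc a b, ‖expSum φ N c x‖ ^ 2) :=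
        (ofReal_integral_eq_lintegral_ofReal hint
          (Filter.Eventually.of_forall fun x => by positivity)).symm
    _ ≤ _ := ENNReal.ofReal_le_ofReal hle

theorem exists_lintegral_expSum_le {φ : ℝ × ℝ → ℝ} (hφ : ContDiffOn ℝ 2 φ Sq)
    (hdet : ∀ p ∈ Sq, iteratedFDerivWithin ℝ 2 φ Sq p ![(1, 0), (1, 0)] *
      iteratedFDerivWithin ℝ 2 φ Sq p ![(0, 1), (0, 1)] -
        iteratedFDerivWithin ℝ 2 φ Sq p ![(1, 0), (0, 1)] ^ 2 ≠ 0) :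
    ∃ C, 0 ≤ C ∧ ∀ N : ℕ, 2 ≤ N → ∀ c : ℤ × ℤ → ℂ, ∫⁻ x in Sq, ‖expSum φ N c x‖ₑ ^ 2 ≤
      ENNReal.ofReal (C * Real.log N ^ 4 * ∑ p ∈ freqBox N, ‖c p‖ ^ 2) := by
  refine isCompact_Sq.induction_on (p := fun t => ∃ C, 0 ≤ C ∧ ∀ N : ℕ, 2 ≤ N →
    ∀ c : ℤ × ℤ → ℂ, ∫⁻ x in t, ‖expSum φ N c x‖ₑ ^ 2 ≤
      ENNReal.ofReal (C * Real.log N ^ 4 * ∑ p ∈ freqBox N, ‖c p‖ ^ 2)) ?_ ?_ ?_ ?_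
  · exact ⟨0, le_rfl, fun N _ c => by simp⟩
  · rintro s t hst ⟨C, hC, h⟩
    exact ⟨C, hC, fun N hN c => (lintegral_mono_set hst).trans (h N hN c)⟩
  · rintro s t ⟨C, hC, h⟩ ⟨C', hC', h'⟩
    refine ⟨C + C', add_nonneg hC hC', fun N hN c => ?_⟩
    rw [add_mul, add_mul, ENNReal.ofReal_add (by positivity) (by positivity)]
    exact (lintegral_union_le _ _ _).trans (add_le_add (h N hN c) (h' N hN c))
  · intro p hp
    obtain ⟨a, b, hsub, hpab, hnhds, c₀, hc₀, hanti⟩ :=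
      exists_box_gradSq_antilipschitz hφ hp (hdet p hp)
    obtain ⟨C, hC, hosc⟩ := exists_oscillatory_bound hφ hsub hpab hc₀ hanti
    obtain ⟨D, hD, hK⟩ := exists_kernel_bound hC hosc
    exact ⟨Set.Icc a b, hnhds, 700 * D, by positivity, fun N hN c =>
      exists_local_bound (hφ.continuousOn.mono hsub) hD hN (hK N hN) c⟩

/-- **Theorem 6 (Demeter–Langowski, 2D).** If `φ : [-1,1]² → ℝ` is `C²` with nonzero
Hessian determinant `inf |φ_xx φ_yy − φ_xy²| > 0`, then there are `C > 0` and `A ≥ 0`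
(depending only on `φ`) such that for every `N ≥ 2` and all `(a_{n,m})_{n,m=-N}^N`,
`‖∑ a_{n,m} e(nx + my + (n²+m²)φ(x,y))‖_{L²([-1,1]²)} ≤ C (log N)^A (∑ |a_{n,m}|²)^{1/2}`. -/
theorem stmt11 (φ : ℝ × ℝ → ℝ)
    (hφ : ContDiffOn ℝ 2 φ Sq)
    (hhess : ∃ ε > 0, ∀ p ∈ Sq,
      ε ≤ |iteratedFDerivWithin ℝ 2 φ Sq p ![(1, 0), (1, 0)] *
            iteratedFDerivWithin ℝ 2 φ Sq p ![(0, 1), (0, 1)] -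
            iteratedFDerivWithin ℝ 2 φ Sq p ![(1, 0), (0, 1)] ^ 2|) :
    ∃ C > 0, ∃ A : ℝ, 0 ≤ A ∧ ∀ N : ℕ, 2 ≤ N → ∀ a : ℤ → ℤ → ℂ,
      eLpNorm (fun p : ℝ × ℝ =>
          ∑ n ∈ Finset.Icc (-(N:ℤ)) (N:ℤ), ∑ m ∈ Finset.Icc (-(N:ℤ)) (N:ℤ),
            a n m * e ((n:ℝ) * p.1 + (m:ℝ) * p.2 + ((n:ℝ)^2 + (m:ℝ)^2) * φ p)) 2
        (volume.restrict Sq)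
      ≤ ENNReal.ofReal
          (C * Real.log N ^ A *
            Real.sqrt (∑ n ∈ Finset.Icc (-(N:ℤ)) (N:ℤ),
              ∑ m ∈ Finset.Icc (-(N:ℤ)) (N:ℤ), ‖a n m‖^2)) := by
  obtain ⟨ε, hε, hbd⟩ := hhess
  obtain ⟨C, hC, h⟩ := exists_lintegral_expSum_le hφ fun p hp h0 => by
    have := hbd p hp
    rw [h0, abs_zero] at this
    linarith
  refine ⟨√(C + 1), Real.sqrt_pos.2 (by linarith), 2, zero_le_two, fun N hN a => ?_⟩
  have hL : 0 ≤ Real.log N := by linarith [one_le_two_mul_log hN]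
  have hF : (fun p : ℝ × ℝ =>
      ∑ n ∈ Finset.Icc (-(N:ℤ)) (N:ℤ), ∑ m ∈ Finset.Icc (-(N:ℤ)) (N:ℤ),
        a n m * e ((n:ℝ) * p.1 + (m:ℝ) * p.2 + ((n:ℝ)^2 + (m:ℝ)^2) * φ p)) =
      expSum φ N fun q => a q.1 q.2 := by
    funext p
    rw [expSum, freqBox, Finset.sum_product]
    rfl
  have hS : ∑ n ∈ Finset.Icc (-(N:ℤ)) (N:ℤ), ∑ m ∈ Finset.Icc (-(N:ℤ)) (N:ℤ), ‖a n m‖ ^ 2 =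
      ∑ q ∈ freqBox N, ‖a q.1 q.2‖ ^ 2 := by
    rw [freqBox, Finset.sum_product]
  rw [hF, hS, eLpNorm_eq_lintegral_rpow_enorm_toReal two_ne_zero ENNReal.ofNat_ne_top]
  simp only [ENNReal.toReal_ofNat, ENNReal.rpow_two, Real.rpow_two]
  set S := ∑ q ∈ freqBox N, ‖a q.1 q.2‖ ^ 2 with hSdef
  have hS0 : 0 ≤ S := by positivity
  have hsq : √(C + 1) * Real.log N ^ 2 * √S = ((C + 1) * Real.log N ^ 4 * S) ^ (1 / 2 : ℝ) := by
    rw [← Real.sqrt_eq_rpow, Real.sqrt_mul (by positivity), Real.sqrt_mul (by positivity),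
      show Real.log N ^ 4 = (Real.log N ^ 2) ^ 2 by ring, Real.sqrt_sq (by positivity)]
  rw [hsq, ← ENNReal.ofReal_rpow_of_nonneg (by positivity) (by norm_num)]
  refine ENNReal.rpow_le_rpow ((h N hN _).trans (ENNReal.ofReal_le_ofReal ?_)) (by norm_num)
  gcongr
  linarith
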